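/- arXiv:2301.02022 — 2 statements merged into one kernel-verified Lean document; each statement's English description precedes it below -/
import Mathlib

section
/- Let ε ∈ (0, π/2), let c > 0, and let (z_k)_{k ∈ I} be a countable (possibly finite) family of nonzero complex numbers with Σ_{k ∈ I} 1/|z_k| < ∞ and |arg z_k| > π/2 + ε for every k ∈ I. Let f(z) := c · ∏_{k ∈ I} (1 − z/z_k) (this infinite product converges and defines an entire function of genus zero with no zeros in the sector |arg z| ≤ π/2 + ε), and assume that f(r) is a positive real number for every real r > 0. Let a(r) := r f′(r)/f(r) and b(r) := r a′(r) for r > 0. Then for every real r > 0 such that b(r) > 0 and 8 · b(r)^{−1/5} · csc²(ε/2) · csc(ε) ≤ log 2, and every real θ with |θ| ≤ π, the following universal bound holds: |f(r e^{iθ})| ≤ 2 f(r) e^{−θ² b(r)/2} whenever |θ| ≤ b(r)^{−2/5}, and |f(r e^{iθ})| ≤ 2 f(r) e^{−b(r)^{1/5}/2} whenever b(r)^{−2/5} ≤ |θ| ≤ π. -/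
open Real

/-- The second logarithmic derivative `(s d/ds)² log (1 - s / z)` of the factor with zero `z`. -/
noncomputable def factorCurvature (s : ℝ) (z : ℂ) : ℂ := -(s * z) / (s - z) ^ 2

lemma re_le_neg_sin_mul_norm {ε : ℝ} (hε : 0 < ε) {z : ℂ}
    (harg : π / 2 + ε < |Complex.arg z|) : z.re ≤ -(Real.sin ε * ‖z‖) := by
  have h1 : Real.cos |Complex.arg z| ≤ Real.cos (π / 2 + ε) :=
    Real.cos_le_cos_of_nonneg_of_le_pi (by positivity) (Complex.abs_arg_le_pi z) harg.le
  rw [Real.cos_abs, add_comm, Real.cos_add_pi_div_two] at h1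
  have h2 := Complex.norm_mul_cos_arg z
  nlinarith [norm_nonneg z]

lemma sq_add_sq_le_norm_sub_sq {s : ℝ} (hs : 0 ≤ s) {z : ℂ} (hz : z.re ≤ 0) :
    s ^ 2 + ‖z‖ ^ 2 ≤ ‖(s : ℂ) - z‖ ^ 2 := by
  simp only [Complex.sq_norm, Complex.normSq_apply, Complex.sub_re, Complex.sub_im,
    Complex.ofReal_re, Complex.ofReal_im]
  nlinarith [mul_nonneg hs (neg_nonneg.2 hz)]

lemma ofReal_sub_ne_zero {s : ℝ} (hs : 0 < s) {z : ℂ} (hz : z.re ≤ 0) : (s : ℂ) - z ≠ 0 := by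
  intro h
  have := congrArg Complex.re h
  simp at this
  linarith

lemma norm_inv_sub_le {s : ℝ} (hs : 0 < s) {z : ℂ} (hz0 : z ≠ 0) (hz : z.re ≤ 0) :
    ‖1 / ((s : ℂ) - z)‖ ≤ 1 / ‖z‖ := by
  have := sq_add_sq_le_norm_sub_sq hs.le hz
  have h0 : 0 < ‖z‖ := norm_pos_iff.2 hz0
  rw [norm_div, norm_one]
  refine one_div_le_one_div_of_le h0 ?_
  exact le_of_sq_le_sq (by nlinarith) (norm_nonneg _)

lemma norm_neg_div_sub_sq_le {s : ℝ} (hs : 0 < s) {z : ℂ} (hz0 : z ≠ 0) (hz : z.re ≤ 0) :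
    ‖-z / ((s : ℂ) - z) ^ 2‖ ≤ 1 / ‖z‖ := by
  have := sq_add_sq_le_norm_sub_sq hs.le hz
  have h0 : 0 < ‖z‖ := norm_pos_iff.2 hz0
  rw [norm_div, norm_neg, norm_pow, div_le_div_iff₀ (by nlinarith) h0]
  nlinarith

lemma norm_factorCurvature {s : ℝ} (hs : 0 < s) (z : ℂ) :
    ‖factorCurvature s z‖ = s * ‖z‖ / ‖(s : ℂ) - z‖ ^ 2 := by
  simp [factorCurvature, abs_of_pos hs]

lemma norm_factorCurvature_le_half {s : ℝ} (hs : 0 < s) {z : ℂ} (hz : z.re ≤ 0) :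
    ‖factorCurvature s z‖ ≤ 1 / 2 := by
  have := sq_add_sq_le_norm_sub_sq hs.le hz
  rw [norm_factorCurvature hs, div_le_div_iff₀ (by nlinarith [norm_nonneg z]) two_pos]
  nlinarith [sq_nonneg (s - ‖z‖)]

lemma factorCurvature_re {s : ℝ} (hs : 0 < s) {z : ℂ} (hz : z.re ≤ 0) :
    (factorCurvature s z).re =
      s * (-z.re * (s ^ 2 + ‖z‖ ^ 2) + 2 * s * ‖z‖ ^ 2) / (‖(s : ℂ) - z‖ ^ 2) ^ 2 := by
  have h0 := ofReal_sub_ne_zero hs hz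
  have h1 : ‖(s : ℂ) - z‖ ^ 2 ≠ 0 := pow_ne_zero 2 (norm_ne_zero_iff.2 h0)
  simp only [Complex.sq_norm, factorCurvature, Complex.div_re, pow_two ((s : ℂ) - z),
    map_mul] at h1 ⊢
  field_simp
  simp [Complex.normSq_apply, pow_two]
  ring

lemma mul_norm_factorCurvature_le_re {s δ : ℝ} (hs : 0 < s) (hδ0 : 0 ≤ δ) {z : ℂ}
    (hz : z.re ≤ -(δ * ‖z‖)) : δ * ‖factorCurvature s z‖ ≤ (factorCurvature s z).re := by
  have hz' : z.re ≤ 0 := hz.trans (by have := norm_nonneg z; nlinarith [mul_nonneg hδ0 this])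
  have h0 := ofReal_sub_ne_zero hs hz'
  have hp := norm_nonneg z
  have h1 : 0 < ‖(s : ℂ) - z‖ ^ 2 := pow_pos (norm_pos_iff.2 h0) 2
  have h2 : ‖(s : ℂ) - z‖ ^ 2 = s ^ 2 + ‖z‖ ^ 2 - 2 * s * z.re := by
    simp only [Complex.sq_norm, Complex.normSq_apply, Complex.sub_re, Complex.sub_im,
      Complex.ofReal_re, Complex.ofReal_im]
    ring
  have hre : -z.re ≤ ‖z‖ := (neg_le_abs _).trans (Complex.abs_re_le_norm z)
  rw [factorCurvature_re hs hz', norm_factorCurvature hs, ← mul_div_assoc,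
    div_le_div_iff₀ h1 (by positivity), pow_two (‖(s : ℂ) - z‖ ^ 2), ← mul_assoc]
  refine mul_le_mul_of_nonneg_right ?_ h1.le
  rw [h2]
  have h3 : δ * ‖z‖ * (s ^ 2 + ‖z‖ ^ 2) ≤ -z.re * (s ^ 2 + ‖z‖ ^ 2) :=
    mul_le_mul_of_nonneg_right (by linarith) (by positivity)
  have h4 : δ * (-z.re) ≤ ‖z‖ := by nlinarith
  have h5 : ‖z‖ * s * (δ * (-z.re)) ≤ ‖z‖ * s * ‖z‖ :=
    mul_le_mul_of_nonneg_left h4 (by positivity)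
  have h6 := mul_le_mul_of_nonneg_left h3 hs.le
  have h7 := mul_le_mul_of_nonneg_left h5 hs.le
  nlinarith

lemma norm_one_sub_four_mul_factorCurvature_le {s δ : ℝ} (hs : 0 < s) (hδ0 : 0 ≤ δ) {z : ℂ}
    (hz : z.re ≤ -(δ * ‖z‖)) :
    ‖1 - 4 * factorCurvature s z‖ ≤ 1 - 4 * (δ * ‖factorCurvature s z‖) := by
  have hz' : z.re ≤ 0 := hz.trans (by have := norm_nonneg z; nlinarith [mul_nonneg hδ0 this])
  have h0 := ofReal_sub_ne_zero hs hz'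
  have h1 : 0 < ‖(s : ℂ) - z‖ ^ 2 := pow_pos (norm_pos_iff.2 h0) 2
  have h2 : (1 : ℂ) - 4 * factorCurvature s z = (s + z) ^ 2 / (s - z) ^ 2 := by
    rw [factorCurvature]; field_simp; ring
  rw [h2, norm_factorCurvature hs, norm_div, norm_pow, norm_pow, div_le_iff₀ h1, sub_mul, one_mul]
  have : 4 * (δ * (s * ‖z‖ / ‖(s : ℂ) - z‖ ^ 2)) * ‖(s : ℂ) - z‖ ^ 2 = 4 * s * (δ * ‖z‖) := by
    field_simp
  rw [this]
  have h3 : ‖(s : ℂ) + z‖ ^ 2 = ‖(s : ℂ) - z‖ ^ 2 + 4 * s * z.re := by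
    simp only [Complex.sq_norm, Complex.normSq_apply, Complex.sub_re, Complex.sub_im,
      Complex.add_re, Complex.add_im, Complex.ofReal_re, Complex.ofReal_im]
    ring
  rw [h3]
  nlinarith

lemma norm_one_sub_mul_factorCurvature_le {s δ σ : ℝ} (hs : 0 < s) (hδ0 : 0 ≤ δ)
    (hσ0 : 0 ≤ σ) (hσ4 : σ ≤ 4) {z : ℂ} (hz : z.re ≤ -(δ * ‖z‖)) :
    ‖1 - σ * factorCurvature s z‖ ≤ 1 - σ * (δ * ‖factorCurvature s z‖) := by
  have h4 := norm_one_sub_four_mul_factorCurvature_le hs hδ0 hz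
  set q := factorCurvature s z
  have : (1 : ℂ) - σ * q = ((1 - σ / 4 : ℝ) : ℂ) + ((σ / 4 : ℝ) : ℂ) * (1 - 4 * q) := by
    push_cast; ring
  rw [this]
  refine (norm_add_le _ _).trans ?_
  rw [norm_mul, Complex.norm_of_nonneg (by linarith), Complex.norm_of_nonneg (by linarith)]
  nlinarith

lemma norm_one_sub_mul_le_exp (σ : ℝ) (q : ℂ) :
    ‖1 - σ * q‖ ≤ Real.exp (-σ * q.re + σ ^ 2 * ‖q‖ ^ 2 / 2) := by
  have h : ‖1 - σ * q‖ ^ 2 = 1 + (-2 * σ * q.re + σ ^ 2 * ‖q‖ ^ 2) := by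
    simp [Complex.sq_norm, Complex.normSq_apply]
    ring
  refine le_of_sq_le_sq ?_ (Real.exp_pos _).le
  rw [h, ← Real.exp_nat_mul, add_comm]
  refine (Real.add_one_le_exp _).trans (Real.exp_le_exp.2 (le_of_eq ?_))
  push_cast
  ring

lemma norm_one_sub_div_mul_norm_one_sub_div {s : ℝ} (hs : 0 < s) (θ : ℝ) {z : ℂ} (hz0 : z ≠ 0)
    (hz : z.re ≤ 0) :
    ‖1 - s * Complex.exp (θ * Complex.I) / z‖ * ‖1 - s * Complex.exp (-(θ * Complex.I)) / z‖ =
      ‖1 - s / z‖ ^ 2 * ‖1 - ((2 * (1 - Real.cos θ) : ℝ) : ℂ) * factorCurvature s z‖ := by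
  have h0 := ofReal_sub_ne_zero hs hz
  rw [← norm_pow, ← norm_mul, ← norm_mul]
  congr 1
  have hc : ((2 * (1 - Real.cos θ) : ℝ) : ℂ) =
      2 - Complex.exp (θ * Complex.I) - Complex.exp (-(θ * Complex.I)) := by
    push_cast
    rw [Complex.cos, neg_mul]; ring
  have he : Complex.exp (θ * Complex.I) * Complex.exp (-(θ * Complex.I)) = 1 := by
    rw [← Complex.exp_add]; simp
  rw [hc, factorCurvature]
  generalize Complex.exp (θ * Complex.I) = E at *
  generalize Complex.exp (-(θ * Complex.I)) = F at *
  have h1 : (1 - (s : ℂ) / z) ^ 2 = (s - z) ^ 2 / z ^ 2 := by field_simp; ring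
  rw [h1]
  field_simp
  linear_combination s ^ 2 * he

lemma hasDerivAt_log_norm_one_sub_div {s : ℝ} (hs : 0 < s) {z : ℂ} (hz0 : z ≠ 0) (hz : z.re ≤ 0) :
    HasDerivAt (fun t : ℝ => Real.log ‖1 - (t : ℂ) / z‖) (1 / ((s : ℂ) - z)).re s := by
  have h0 := ofReal_sub_ne_zero hs hz
  have hre : 0 < (1 - (s : ℂ) / z).re := by
    have : ((s : ℂ) / z).re ≤ 0 := by
      rw [Complex.div_re]
      simp only [Complex.ofReal_re, Complex.ofReal_im, zero_mul, zero_div, add_zero]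
      exact div_nonpos_of_nonpos_of_nonneg (mul_nonpos_of_nonneg_of_nonpos hs.le hz)
        (Complex.normSq_nonneg z)
    rw [Complex.sub_re, Complex.one_re]
    linarith
  have h1 : HasDerivAt (fun w : ℂ => 1 - w / z) (-(1 / z)) (s : ℂ) := by
    simpa using ((hasDerivAt_id (s : ℂ)).div_const z).const_sub 1
  have h2 := (h1.clog (Or.inl hre)).real_of_complex
  simp only [Complex.log_re] at h2
  convert! h2 using 2
  have h3 : 1 - (s : ℂ) / z ≠ 0 := fun h => by rw [h] at hre; simp at hre
  have h4 : z - s ≠ 0 := fun h => h0 (by linear_combination -h)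
  field_simp
  ring

lemma hasDerivAt_mul_one_div_sub_re {s : ℝ} (hs : 0 < s) {z : ℂ} (hz : z.re ≤ 0) :
    HasDerivAt (fun t : ℝ => t * (1 / ((t : ℂ) - z)).re) (-z / ((s : ℂ) - z) ^ 2).re s := by
  have h0 := ofReal_sub_ne_zero hs hz
  have h1 : HasDerivAt (fun w : ℂ => w / (w - z)) (-z / ((s : ℂ) - z) ^ 2) (s : ℂ) := by
    convert! (hasDerivAt_id (s : ℂ)).div ((hasDerivAt_id (s : ℂ)).sub_const z) h0 using 2
    simp
  convert! h1.real_of_complex using 2 with t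
  rw [div_eq_mul_one_div (t : ℂ), Complex.re_ofReal_mul]

lemma summable_log_norm_one_sub_div {ι : Type*} {z : ι → ℂ} (hz0 : ∀ k, z k ≠ 0)
    (hz : ∀ k, (z k).re ≤ 0) (hsum : Summable fun k => 1 / ‖z k‖) {s : ℝ} (hs : 0 < s) :
    Summable fun k => Real.log ‖1 - (s : ℂ) / z k‖ := by
  have hge : ∀ k, 1 ≤ ‖1 - (s : ℂ) / z k‖ := fun k => by
    have h0 : 0 < ‖z k‖ := norm_pos_iff.2 (hz0 k)
    have h1 := sq_add_sq_le_norm_sub_sq hs.le (hz k)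
    have h2 : 1 - (s : ℂ) / z k = -((s - z k) / z k) := by
      have := hz0 k
      field_simp; ring
    rw [h2, norm_neg, norm_div, one_le_div h0]
    exact le_of_sq_le_sq (by nlinarith) (norm_nonneg _)
  refine Summable.of_nonneg_of_le (fun k => Real.log_nonneg (hge k)) (fun k => ?_)
    (hsum.mul_left s)
  have h1 : ‖1 - (s : ℂ) / z k‖ ≤ 1 + s * (1 / ‖z k‖) := by
    refine (norm_sub_le _ _).trans (le_of_eq ?_)
    rw [norm_one, norm_div, Complex.norm_of_nonneg hs.le, mul_one_div]
  linarith [Real.log_le_sub_one_of_pos (zero_lt_one.trans_le (hge k))]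

lemma hasDerivAt_tsum_log_norm_one_sub_div {ι : Type*} {z : ι → ℂ} (hz0 : ∀ k, z k ≠ 0)
    (hz : ∀ k, (z k).re ≤ 0) (hsum : Summable fun k => 1 / ‖z k‖) {s : ℝ} (hs : 0 < s) :
    HasDerivAt (fun t : ℝ => ∑' k, Real.log ‖1 - (t : ℂ) / z k‖)
      (∑' k, (1 / ((s : ℂ) - z k)).re) s :=
  hasDerivAt_tsum_of_isPreconnected hsum isOpen_Ioi (convex_Ioi (0 : ℝ)).isPreconnected
    (fun k _ ht => hasDerivAt_log_norm_one_sub_div ht (hz0 k) (hz k))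
    (fun k _ ht => (Complex.abs_re_le_norm _).trans (norm_inv_sub_le ht (hz0 k) (hz k)))
    hs (summable_log_norm_one_sub_div hz0 hz hsum hs) hs

lemma hasDerivAt_mul_tsum_one_div_sub_re {ι : Type*} {z : ι → ℂ} (hz0 : ∀ k, z k ≠ 0)
    (hz : ∀ k, (z k).re ≤ 0) (hsum : Summable fun k => 1 / ‖z k‖) {s : ℝ} (hs : 0 < s) :
    HasDerivAt (fun t : ℝ => t * ∑' k, (1 / ((t : ℂ) - z k)).re)
      (∑' k, (-z k / ((s : ℂ) - z k) ^ 2).re) s := by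
  simp only [← tsum_mul_left]
  refine hasDerivAt_tsum_of_isPreconnected hsum isOpen_Ioi (convex_Ioi (0 : ℝ)).isPreconnected
    (fun k _ ht => hasDerivAt_mul_one_div_sub_re ht (hz k))
    (fun k _ ht => (Complex.abs_re_le_norm _).trans (norm_neg_div_sub_sq_le ht (hz0 k) (hz k)))
    hs (Summable.mul_left s ?_) hs
  exact Summable.of_norm_bounded hsum fun k =>
    (Complex.abs_re_le_norm _).trans (norm_inv_sub_le hs (hz0 k) (hz k))

lemma factorCurvature_eq (s : ℝ) (z : ℂ) :
    factorCurvature s z = (s : ℂ) * (-z / ((s : ℂ) - z) ^ 2) := by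
  rw [factorCurvature]; ring

lemma summable_factorCurvature_re {ι : Type*} {z : ι → ℂ} (hz0 : ∀ k, z k ≠ 0)
    (hz : ∀ k, (z k).re ≤ 0) (hsum : Summable fun k => 1 / ‖z k‖) {s : ℝ} (hs : 0 < s) :
    Summable fun k => (factorCurvature s (z k)).re := by
  simp only [factorCurvature_eq, Complex.re_ofReal_mul]
  exact (Summable.of_norm_bounded hsum fun k => (Complex.abs_re_le_norm _).trans
    (norm_neg_div_sub_sq_le hs (hz0 k) (hz k))).mul_left s

/-- The second logarithmic derivative of a canonical product of genus zero. -/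
lemma mul_deriv_mul_deriv_div_eq_tsum {ι : Type*} {z : ι → ℂ} (hz0 : ∀ k, z k ≠ 0)
    (hz : ∀ k, (z k).re ≤ 0) (hsum : Summable fun k => 1 / ‖z k‖) {c : ℝ} (hc : 0 < c)
    {g A : ℝ → ℝ} (hg : ∀ s, 0 < s → g s = c * ∏' k, ‖1 - (s : ℂ) / z k‖)
    (hA : ∀ s, 0 < s → A s = s * deriv g s / g s) {r : ℝ} (hr : 0 < r) :
    r * deriv A r = ∑' k, (factorCurvature r (z k)).re := by
  have hpos : ∀ s : ℝ, 0 < s → ∀ k, 0 < ‖1 - (s : ℂ) / z k‖ := fun s hs k => by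
    refine norm_pos_iff.2 fun h => ofReal_sub_ne_zero hs (hz k) ?_
    have := hz0 k
    field_simp at h
    linear_combination -h
  have hg' : ∀ s, 0 < s → g s = c * Real.exp (∑' k, Real.log ‖1 - (s : ℂ) / z k‖) :=
    fun s hs => by
      rw [hg s hs, Real.rexp_tsum_eq_tprod (hpos s hs)
        (summable_log_norm_one_sub_div hz0 hz hsum hs)]
  have hA' : ∀ s, 0 < s → A s = s * ∑' k, (1 / ((s : ℂ) - z k)).re := fun s hs => by
    have hd := ((hasDerivAt_tsum_log_norm_one_sub_div hz0 hz hsum hs).exp.const_mul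
      c).congr_of_eventuallyEq (f₁ := g) (by
        filter_upwards [Ioi_mem_nhds hs] with t ht using hg' t ht)
    rw [hA s hs, hd.deriv, hg' s hs]
    have := Real.exp_pos (∑' k, Real.log ‖1 - (s : ℂ) / z k‖)
    field_simp
  have hd := (hasDerivAt_mul_tsum_one_div_sub_re hz0 hz hsum hr).congr_of_eventuallyEq
    (f₁ := A) (by filter_upwards [Ioi_mem_nhds hr] with t ht using hA' t ht)
  rw [hd.deriv, ← tsum_mul_left]
  simp only [factorCurvature_eq, Complex.re_ofReal_mul]

lemma differentiable_tprod_one_sub_div {ι : Type*} {z : ι → ℂ}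
    (hsum : Summable fun k => 1 / ‖z k‖) : Differentiable ℂ fun w => ∏' k, (1 - w / z k) := by
  intro w
  have hopen : IsOpen (Metric.ball (0 : ℂ) (‖w‖ + 1)) := Metric.isOpen_ball
  have h := Summable.hasProdLocallyUniformlyOn_one_add (f := fun k (w : ℂ) => -(w / z k)) hopen
    (hsum.mul_left (‖w‖ + 1)) (Filter.Eventually.of_forall fun k x hx => by
      rw [norm_neg, norm_div, ← mul_one_div]
      exact mul_le_mul_of_nonneg_right (mem_ball_zero_iff.1 hx).le (by positivity))
    (fun k => by fun_prop)
  simp only [← sub_eq_add_neg] at h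
  refine (TendstoLocallyUniformlyOn.differentiableOn
    (hasProdLocallyUniformlyOn_iff_tendstoLocallyUniformlyOn.1 h)
    (Filter.Eventually.of_forall fun s => ?_) hopen).differentiableAt (hopen.mem_nhds (by simp))
  fun_prop

/-- The Schwarz reflection principle for an entire function real on the positive real axis. -/
lemma apply_conj_of_im_eq_zero {f : ℂ → ℂ} (hf : Differentiable ℂ f)
    (hreal : ∀ r : ℝ, 0 < r → (f r).im = 0) (w : ℂ) :
    f ((starRingEnd ℂ) w) = (starRingEnd ℂ) (f w) := by
  have hg : Differentiable ℂ (starRingEnd ℂ ∘ f ∘ starRingEnd ℂ) := fun w =>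
    differentiableAt_conj_conj_iff.2 (hf _)
  have key : starRingEnd ℂ ∘ f ∘ starRingEnd ℂ = f := by
    refine AnalyticOnNhd.eq_of_frequently_eq (z₀ := ((1 : ℝ) : ℂ))
      (fun w _ => hg.analyticAt w) (fun w _ => hf.analyticAt w) ?_
    have h1 : Filter.Tendsto (fun t : ℝ => (t : ℂ)) (nhdsWithin 1 {1}ᶜ)
        (nhdsWithin ((1 : ℝ) : ℂ) {((1 : ℝ) : ℂ)}ᶜ) :=
      tendsto_nhdsWithin_of_tendsto_nhds_of_eventually_within _
        (Complex.continuous_ofReal.continuousAt.tendsto.mono_left nhdsWithin_le_nhds)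
        (by filter_upwards [self_mem_nhdsWithin] with t ht using by simpa using ht)
    refine h1.frequently (Filter.Eventually.frequently ?_)
    filter_upwards [nhdsWithin_le_nhds (Ioi_mem_nhds one_pos)] with t ht
    simp only [Function.comp_apply, Complex.conj_ofReal]
    exact Complex.conj_eq_iff_im.2 (hreal t ht)
  have := congrFun key ((starRingEnd ℂ) w)
  simpa using this.symm

/-- If every factor obeys an exponential bound governed by its curvature, so does the product. -/
lemma norm_le_mul_exp_of_factor_le {ι : Type*} {z : ι → ℂ} (hz0 : ∀ k, z k ≠ 0)
    (hz : ∀ k, (z k).re ≤ 0) (hsum : Summable fun k => 1 / ‖z k‖) {c : ℝ} {f : ℂ → ℂ}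
    (hmul : ∀ w : ℂ, Multipliable fun k => 1 - w / z k)
    (hf : ∀ w : ℂ, f w = (c : ℂ) * ∏' k, (1 - w / z k))
    (hreal : ∀ r : ℝ, 0 < r → (f r).im = 0) {r : ℝ} (hr : 0 < r) (θ κ : ℝ)
    (hfac : ∀ k, ‖1 - ((2 * (1 - Real.cos θ) : ℝ) : ℂ) * factorCurvature r (z k)‖ ≤
      Real.exp (κ * (factorCurvature r (z k)).re)) :
    ‖f (r * Complex.exp (θ * Complex.I))‖ ≤
      ‖f r‖ * Real.exp (κ * (∑' k, (factorCurvature r (z k)).re) / 2) := by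
  have hdiff : Differentiable ℂ f := by
    rw [funext hf]
    exact (differentiable_tprod_one_sub_div hsum).const_mul _
  have hconj : ‖f (r * Complex.exp (-(θ * Complex.I)))‖ = ‖f (r * Complex.exp (θ * Complex.I))‖ := by
    rw [← Complex.norm_conj (f (r * Complex.exp (θ * Complex.I))),
      ← apply_conj_of_im_eq_zero hdiff hreal, map_mul, Complex.conj_ofReal, ← Complex.exp_conj]
    simp
  have hnorm : ∀ w, HasProd (fun k => ‖1 - w / z k‖) ‖∏' k, (1 - w / z k)‖ := fun w =>
    (hmul w).hasProd.norm
  have hexp := ((summable_factorCurvature_re hz0 hz hsum hr).hasSum.mul_left κ).rexp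
  have key : ‖∏' k, (1 - r * Complex.exp (θ * Complex.I) / z k)‖ *
      ‖∏' k, (1 - r * Complex.exp (-(θ * Complex.I)) / z k)‖ ≤
      ‖∏' k, (1 - (r : ℂ) / z k)‖ * ‖∏' k, (1 - (r : ℂ) / z k)‖ *
        Real.exp (κ * ∑' k, (factorCurvature r (z k)).re) := by
    refine le_of_tendsto_of_tendsto'
      ((hnorm (r * Complex.exp (θ * Complex.I))).mul (hnorm (r * Complex.exp (-(θ * Complex.I)))))
      (((hnorm r).mul (hnorm r)).mul hexp) fun s => Finset.prod_le_prod
        (fun k _ => by positivity) fun k _ => ?_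
    rw [norm_one_sub_div_mul_norm_one_sub_div hr θ (hz0 k) (hz k), ← pow_two]
    exact mul_le_mul_of_nonneg_left (hfac k) (by positivity)
  refine le_of_sq_le_sq ?_ (by positivity)
  rw [mul_pow, ← Real.exp_nat_mul, pow_two]
  nth_rw 2 [← hconj]
  simp only [hf, norm_mul]
  have hexp2 : ((2 : ℕ) : ℝ) * (κ * (∑' k, (factorCurvature r (z k)).re) / 2) =
      κ * ∑' k, (factorCurvature r (z k)).re := by push_cast; ring
  rw [hexp2]
  have := mul_le_mul_of_nonneg_left key (sq_nonneg ‖(c : ℂ)‖)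
  linarith

lemma norm_one_sub_mul_factorCurvature_le_exp_of_sector {s δ σ : ℝ} (hs : 0 < s) (hδ0 : 0 ≤ δ)
    (hσ0 : 0 ≤ σ) (hσ4 : σ ≤ 4) {z : ℂ} (hz : z.re ≤ -(δ * ‖z‖)) :
    ‖1 - σ * factorCurvature s z‖ ≤ Real.exp (-(σ * δ) * (factorCurvature s z).re) := by
  refine (norm_one_sub_mul_factorCurvature_le hs hδ0 hσ0 hσ4 hz).trans ?_
  refine (Real.one_sub_le_exp_neg _).trans (Real.exp_le_exp.2 ?_)
  rw [neg_mul, neg_le_neg_iff, ← mul_assoc]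
  exact mul_le_mul_of_nonneg_left ((le_abs_self _).trans (Complex.abs_re_le_norm _))
    (by positivity)

lemma norm_one_sub_mul_factorCurvature_le_exp {s δ : ℝ} (hs : 0 < s) (hδ0 : 0 < δ)
    (σ : ℝ) {z : ℂ} (hz : z.re ≤ -(δ * ‖z‖)) :
    ‖1 - σ * factorCurvature s z‖ ≤
      Real.exp ((-σ + σ ^ 2 / (4 * δ)) * (factorCurvature s z).re) := by
  have hz' : z.re ≤ 0 := hz.trans (by have := norm_nonneg z; nlinarith [mul_nonneg hδ0.le this])
  refine (norm_one_sub_mul_le_exp σ _).trans (Real.exp_le_exp.2 ?_)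
  have h1 := norm_factorCurvature_le_half hs hz'
  have h2 := mul_norm_factorCurvature_le_re hs hδ0.le hz
  set q := factorCurvature s z
  have h3 : ‖q‖ ^ 2 ≤ q.re / (2 * δ) := by
    rw [le_div_iff₀ (by positivity)]
    have hq := mul_le_mul_of_nonneg_left h2 (norm_nonneg q)
    have hq' := mul_le_mul_of_nonneg_right h1 ((mul_nonneg hδ0.le (norm_nonneg q)).trans h2)
    linarith
  have h4 := mul_le_mul_of_nonneg_left h3 (sq_nonneg σ)
  have h5 : σ ^ 2 * (q.re / (2 * δ)) / 2 = σ ^ 2 / (4 * δ) * q.re := by field_simp; ring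
  linarith

lemma abs_two_mul_one_sub_cos_sub_sq_le {x : ℝ} (hx : |x| ≤ 1) :
    |2 * (1 - Real.cos x) - x ^ 2| ≤ x ^ 4 * (5 / 48) := by
  have h := Real.cos_bound hx
  rw [Even.pow_abs (by decide)] at h
  rw [abs_le] at h ⊢
  constructor <;> linarith

lemma small_angle_exponent_le {y δ θ : ℝ} (hy : 0 < y) (hδ1 : δ ≤ 1) (hyδ : 8 * y ≤ δ)
    (hθ : |θ| ≤ y ^ 2) :
    (-(2 * (1 - Real.cos θ)) + (2 * (1 - Real.cos θ)) ^ 2 / (4 * δ)) * (y ^ 5)⁻¹ / 2 ≤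
      1 / 2 - θ ^ 2 * (y ^ 5)⁻¹ / 2 := by
  have hy1 : y ≤ 1 / 8 := by linarith
  have hδ : 0 < δ := by linarith
  have hc := abs_le.1 (abs_two_mul_one_sub_cos_sub_sq_le (x := θ) (by nlinarith))
  have hσ0 : 0 ≤ 2 * (1 - Real.cos θ) := by linarith [Real.cos_le_one θ]
  have hσ : 2 * (1 - Real.cos θ) ≤ θ ^ 2 := by
    linarith [Real.one_sub_sq_div_two_le_cos (x := θ)]
  set σ := 2 * (1 - Real.cos θ)
  have ht : θ ^ 4 ≤ y ^ 8 := by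
    have := pow_le_pow_left₀ (abs_nonneg θ) hθ 4
    rw [Even.pow_abs (by decide), ← pow_mul] at this
    exact this
  have hs : σ ^ 2 ≤ y ^ 8 := by nlinarith
  have h1 : σ ^ 2 / (4 * δ) ≤ y ^ 7 / 32 := by
    rw [div_le_div_iff₀ (by positivity) (by norm_num)]
    have := mul_le_mul_of_nonneg_left hyδ (by positivity : 0 ≤ y ^ 7)
    nlinarith
  have h8 : y ^ 8 ≤ y ^ 7 := by
    rw [pow_succ y 7]
    exact mul_le_of_le_one_right (by positivity) (by linarith)
  have h7 : y ^ 7 ≤ y ^ 5 := pow_le_pow_of_le_one hy.le (by linarith) (by norm_num)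
  have h2 : -σ + σ ^ 2 / (4 * δ) ≤ y ^ 5 - θ ^ 2 := by nlinarith [pow_pos hy 5]
  have h3 := mul_le_mul_of_nonneg_right h2 (by positivity : 0 ≤ (y ^ 5)⁻¹)
  rw [sub_mul, mul_inv_cancel₀ (by positivity)] at h3
  linarith

lemma large_angle_exponent_le {y δ σ : ℝ} (hy : 0 < y) (hδ1 : δ ≤ 1) (hyδ : 8 * y ≤ δ)
    (hσ : y ^ 4 - y ^ 8 * (5 / 48) ≤ σ) (hσ' : σ * δ ≤ y ^ 4) :
    (-σ + σ ^ 2 / (4 * δ)) * (y ^ 5)⁻¹ / 2 ≤ 1 / 2 - y⁻¹ / 2 := by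
  have hy1 : y ≤ 1 / 8 := by linarith
  have hδ : 0 < δ := by linarith
  have h8 : y ^ 8 ≤ y ^ 5 := pow_le_pow_of_le_one hy.le (by linarith) (by norm_num)
  have h84 : y ^ 8 ≤ y ^ 4 := pow_le_pow_of_le_one hy.le (by linarith) (by norm_num)
  have hσ0 : 0 ≤ σ := by linarith [pow_pos hy 4]
  have h1 : σ ^ 2 / (4 * δ) ≤ y ^ 5 / 2 := by
    rw [div_le_div_iff₀ (by positivity) (by norm_num)]
    have ha : (σ * δ) ^ 2 ≤ (y ^ 4) ^ 2 := pow_le_pow_left₀ (by positivity) hσ' 2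
    have hb : (8 * y) ^ 3 ≤ δ ^ 3 := pow_le_pow_left₀ (by positivity) hyδ 3
    have hd := mul_le_mul_of_nonneg_left hb (by positivity : 0 ≤ y ^ 5)
    have he : σ ^ 2 * 2 * δ ^ 2 ≤ y ^ 5 * (4 * δ) * δ ^ 2 := by
      nlinarith [pow_pos hy 8, pow_pos hδ 3, pow_pos hy 5]
    exact le_of_mul_le_mul_right he (by positivity)
  have h2 : -σ + σ ^ 2 / (4 * δ) ≤ y ^ 5 - y ^ 4 := by linarith [pow_pos hy 5]
  have h3 := mul_le_mul_of_nonneg_right h2 (by positivity : 0 ≤ (y ^ 5)⁻¹)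
  have h4 : y ^ 4 * (y ^ 5)⁻¹ = y⁻¹ := by field_simp
  rw [sub_mul, mul_inv_cancel₀ (by positivity), h4] at h3
  linarith

lemma le_two_mul_one_sub_cos {y θ : ℝ} (hy : 0 ≤ y) (hy1 : y ≤ 1) (hyθ : y ^ 2 ≤ |θ|)
    (hθ : |θ| ≤ π) : y ^ 4 - y ^ 8 * (5 / 48) ≤ 2 * (1 - Real.cos θ) := by
  have h1 : Real.cos |θ| ≤ Real.cos (y ^ 2) :=
    Real.cos_le_cos_of_nonneg_of_le_pi (by positivity) hθ hyθ
  rw [Real.cos_abs] at h1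
  have h2 := abs_le.1 (abs_two_mul_one_sub_cos_sub_sq_le (x := y ^ 2)
    (by rw [abs_of_nonneg (by positivity)]; exact pow_le_one₀ hy hy1))
  ring_nf at h2 ⊢
  linarith

lemma exp_half_le_two : Real.exp (1 / 2) ≤ 2 := by
  rw [← Real.le_log_iff_exp_le two_pos]
  linarith [Real.log_two_gt_d9]




/-- Hayman's Theorem XI: a universal bound for entire functions of genus zero, positive on
the positive real axis, with no zeros in the sector `|arg z| ≤ π/2 + ε`. -/
theorem stmt_12 {ι : Type} [Countable ι] (ε : ℝ) (hε0 : 0 < ε) (hε1 : ε < π / 2)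
    (c : ℝ) (hc : 0 < c)
    (z : ι → ℂ) (hz : ∀ k, z k ≠ 0)
    (hsum : Summable fun k => 1 / ‖z k‖)
    (harg : ∀ k, π / 2 + ε < |Complex.arg (z k)|)
    (f : ℂ → ℂ)
    (hmul : ∀ w : ℂ, Multipliable fun k => 1 - w / z k)
    (hfdef : ∀ w : ℂ, f w = (c : ℂ) * ∏' k, (1 - w / z k))
    (hfreal : ∀ r : ℝ, 0 < r → (f r).im = 0 ∧ 0 < (f r).re)
    (A B : ℝ → ℝ)
    (hA : ∀ r : ℝ, A r = r * deriv (fun s : ℝ => (f s).re) r / (f r).re)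
    (hB : ∀ r : ℝ, B r = r * deriv A r)
    (r : ℝ) (hr : 0 < r) (hBr : 0 < B r)
    (hcond : 8 * B r ^ (-(1 / 5 : ℝ)) * (1 / Real.sin (ε / 2)) ^ 2 * (1 / Real.sin ε) ≤
      Real.log 2)
    (θ : ℝ) (hθ : |θ| ≤ π) :
    (|θ| ≤ B r ^ (-(2 / 5 : ℝ)) →
      ‖f ((r : ℂ) * Complex.exp ((θ : ℂ) * Complex.I))‖ ≤
        2 * (f r).re * Real.exp (-(θ ^ 2 * B r) / 2)) ∧
    (B r ^ (-(2 / 5 : ℝ)) ≤ |θ| →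
      ‖f ((r : ℂ) * Complex.exp ((θ : ℂ) * Complex.I))‖ ≤
        2 * (f r).re * Real.exp (-(B r ^ ((1 / 5 : ℝ))) / 2)) := by
  set δ := Real.sin ε with hδ
  have hδ0 : 0 < δ := Real.sin_pos_of_pos_of_lt_pi hε0 (by linarith [Real.pi_pos])
  have hδ1 : δ ≤ 1 := Real.sin_le_one ε
  have hsec : ∀ k, (z k).re ≤ -(δ * ‖z k‖) := fun k => re_le_neg_sin_mul_norm hε0 (harg k)
  have hzre : ∀ k, (z k).re ≤ 0 := fun k => (hsec k).trans (by
    have := mul_nonneg hδ0.le (norm_nonneg (z k)); linarith)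
  have hnorm : ∀ s : ℝ, 0 < s → ‖f s‖ = (f s).re := fun s hs => by
    rw [← Complex.abs_re_eq_norm.2 (hfreal s hs).1, abs_of_pos (hfreal s hs).2]
  have hBeq : B r = ∑' k, (factorCurvature r (z k)).re := by
    rw [hB]
    refine mul_deriv_mul_deriv_div_eq_tsum (g := fun s => (f s).re) hz hzre hsum hc
      (fun s hs => ?_) (fun s _ => hA s) hr
    rw [← hnorm s hs, hfdef, norm_mul, Complex.norm_of_nonneg hc.le, (hmul s).norm_tprod]
  set y := B r ^ (-(1 / 5 : ℝ)) with hydef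
  have hy : 0 < y := Real.rpow_pos_of_pos hBr _
  have hy2 : B r ^ (-(2 / 5 : ℝ)) = y ^ 2 := by
    rw [hydef, ← Real.rpow_mul_natCast hBr.le]; norm_num
  have hyinv : B r ^ (1 / 5 : ℝ) = y⁻¹ := by
    rw [hydef, Real.rpow_neg hBr.le, inv_inv]
  have hy5 : B r = (y ^ 5)⁻¹ := by
    rw [hydef, ← Real.rpow_mul_natCast hBr.le]; norm_num [Real.rpow_neg_one]
  have hyδ : 8 * y ≤ δ := by
    have hs0 : 0 < Real.sin (ε / 2) :=
      Real.sin_pos_of_pos_of_lt_pi (by linarith) (by linarith [Real.pi_pos])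
    have h1 : 1 ≤ (1 / Real.sin (ε / 2)) ^ 2 :=
      one_le_pow₀ ((one_le_div hs0).2 (Real.sin_le_one _))
    have h2 : 8 * y * (1 / δ) ≤ Real.log 2 := by
      refine le_trans (mul_le_mul_of_nonneg_right ?_ (by positivity)) hcond
      exact le_mul_of_one_le_right (by positivity) h1
    have h3 : 8 * y / δ ≤ 1 := by
      rw [div_eq_mul_one_div]
      linarith [Real.log_two_lt_d9]
    exact (div_le_one hδ0).1 h3
  have hbound : ∀ κ E : ℝ,
      (∀ k, ‖1 - ((2 * (1 - Real.cos θ) : ℝ) : ℂ) * factorCurvature r (z k)‖ ≤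
        Real.exp (κ * (factorCurvature r (z k)).re)) →
      κ * (y ^ 5)⁻¹ / 2 ≤ 1 / 2 + E →
      ‖f ((r : ℂ) * Complex.exp ((θ : ℂ) * Complex.I))‖ ≤ 2 * (f r).re * Real.exp E := by
    intro κ E hfac hκ
    have h := norm_le_mul_exp_of_factor_le hz hzre hsum hmul hfdef (fun s hs => (hfreal s hs).1)
      hr θ κ hfac
    rw [← hBeq, hy5, hnorm r hr] at h
    refine h.trans ?_
    rw [mul_comm 2, mul_assoc]
    refine mul_le_mul_of_nonneg_left ((Real.exp_le_exp.2 hκ).trans ?_) (hfreal r hr).2.le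
    rw [Real.exp_add]
    exact mul_le_mul_of_nonneg_right exp_half_le_two (Real.exp_pos _).le
  have hfar := fun k => norm_one_sub_mul_factorCurvature_le_exp hr hδ0
    (2 * (1 - Real.cos θ)) (hsec k)
  rw [hy2, hyinv]
  refine ⟨fun hθy => hbound _ _ hfar ?_, fun hθy => ?_⟩
  · have := small_angle_exponent_le hy hδ1 hyδ hθy
    rw [hy5]
    linarith
  · have hlow := le_two_mul_one_sub_cos hy.le (by linarith) hθy hθ
    rcases le_total (2 * (1 - Real.cos θ) * δ) (y ^ 4) with hσ | hσ
    · refine hbound _ _ hfar ?_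
      linarith [large_angle_exponent_le hy hδ1 hyδ hlow hσ]
    · refine hbound (-(2 * (1 - Real.cos θ) * δ)) _ (fun k =>
        norm_one_sub_mul_factorCurvature_le_exp_of_sector hr hδ0.le
          (by linarith [Real.cos_le_one θ]) (by linarith [Real.neg_one_le_cos θ]) (hsec k)) ?_
      have h3 := mul_le_mul_of_nonneg_right hσ (by positivity : 0 ≤ (y ^ 5)⁻¹)
      have h4 : y ^ 4 * (y ^ 5)⁻¹ = y⁻¹ := by field_simp
      rw [h4] at h3
      linarith
end

section
/- Fix ε ∈ (0, π/2), μ ∈ (1/5, 1/3], ν > 0, and K₁, K₂, K₃ > 0. Then there exists n₀ ∈ ℕ, depending only on these constants, with the following property. Let (f_n)_{n ∈ ℕ} be entire functions such that each f_n admits a genus-zero product representation f_n(z) = c_n · ∏_{k ∈ I_n} (1 − z/w_{n,k}) with c_n > 0, nonzero complex numbers w_{n,k}, and Σ_{k ∈ I_n} 1/|w_{n,k}| < ∞; suppose all Maclaurin coefficients of each f_n are positive; suppose that for each n only finitely many of the zeros w_{n,k} — listed with multiplicity as z_{n,1}, …, z_{n,m_n} — satisfy |arg z| ≤ π/2 +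 ε, and none of these is a positive real number; and, writing p_n(z) := ∏_{j=1}^{m_n} (z − z_{n,j}), a_n(r) := r f_n′(r)/f_n(r) and b_n(r) := r a_n′(r), suppose that for all n ∈ ℕ and all real r with n − n^{3/5} ≤ r ≤ n + n^{3/5} one has: |Σ_{j=1}^{m_n} r·z_{n,j}/(r − z_{n,j})²| ≤ K₁ r^{1−μ}; the bound | |p_n(r e^{iθ})| − |p_n(r)| | ≤ K₂ |p_n(r)| r^{−ν} for all real θ with |θ| ≤ π; and |b_n(r) − r| ≤ K₃ r^{2/3}. Then for all n ≥ n₀, all real r with n − n^{3/5} ≤ r ≤ n + n^{3/5}, and all real θ with |θ| ≤ π: |f_n(r e^{iθ})| ≤ 2 f_n(r) e^{−θ² r/2} whenever |θ| ≤ r^{−2/5}, and |f_n(r e^{iθ})| ≤ 2 f_n(r) e^{−r^{1/5}/2} whenever r^{−2/5} ≤ |θ| ≤ π. -/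
open Real

open Filter Topology

/-- Passing to the limit in a factorwise comparison of infinite products, with finitely many
exceptional factors compared as a block. -/
lemma norm_tprod_mul_norm_tprod_le {ι : Type*} {a b c : ι → ℂ} {v : ι → ℝ} {V q : ℝ}
    (S : Finset ι) (ha : Multipliable a) (hb : Multipliable b) (hc : Multipliable c)
    (hv : HasSum v V) (hq : 0 ≤ q)
    (haS : ‖∏ k ∈ S, a k‖ ≤ q * ‖∏ k ∈ S, c k‖) (hbS : ‖∏ k ∈ S, b k‖ ≤ q * ‖∏ k ∈ S, c k‖)
    (h : ∀ k ∉ S, ‖a k‖ * ‖b k‖ ≤ ‖c k‖ ^ 2 * Real.exp (v k)) :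
    ‖∏' k, a k‖ * ‖∏' k, b k‖ ≤
      q ^ 2 * ‖∏' k, c k‖ ^ 2 * Real.exp (V - ∑ k ∈ S, v k) := by
  classical
  have hnorm : ∀ {g : ι → ℂ}, Multipliable g →
      Tendsto (fun T : Finset ι ↦ ‖∏ k ∈ T, g k‖) atTop (𝓝 ‖∏' k, g k‖) :=
    fun hg ↦ Tendsto.norm hg.hasProd
  refine le_of_tendsto_of_tendsto ((hnorm ha).mul (hnorm hb))
    ((((hnorm hc).pow 2).const_mul (q ^ 2)).mul
      ((Real.continuous_exp.tendsto _).comp (Tendsto.sub_const hv (∑ k ∈ S, v k)))) ?_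
  filter_upwards [Filter.eventually_ge_atTop S] with T hT
  have hsplit : ∀ g : ι → ℂ, ‖∏ k ∈ T, g k‖ = (∏ k ∈ T \ S, ‖g k‖) * ‖∏ k ∈ S, g k‖ := fun g ↦ by
    rw [← Finset.prod_sdiff hT, norm_mul, norm_prod]
  have hprod : (∏ k ∈ T \ S, ‖a k‖) * (∏ k ∈ T \ S, ‖b k‖) ≤
      (∏ k ∈ T \ S, ‖c k‖) ^ 2 * Real.exp (∑ k ∈ T \ S, v k) := by
    rw [← Finset.prod_mul_distrib, ← Finset.prod_pow, Real.exp_sum, ← Finset.prod_mul_distrib]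
    exact Finset.prod_le_prod (fun k _ ↦ by positivity)
      fun k hk ↦ h k (Finset.mem_sdiff.1 hk).2
  have hsum : ∑ k ∈ T, v k - ∑ k ∈ S, v k = ∑ k ∈ T \ S, v k := by
    rw [← Finset.sum_sdiff hT, add_sub_cancel_right]
  have hblock := mul_le_mul haS hbS (norm_nonneg _) (by positivity)
  simp only [Function.comp_apply, hsplit, hsum]
  calc _ = ((∏ k ∈ T \ S, ‖a k‖) * (∏ k ∈ T \ S, ‖b k‖)) *
        (‖∏ k ∈ S, a k‖ * ‖∏ k ∈ S, b k‖) := by ring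
    _ ≤ _ := mul_le_mul hprod hblock (by positivity) (by positivity)
    _ = _ := by ring

/-- For `w` in a left sector, `u = r w / (r - w)²` has real part at most `-(2 + 2δ) |u|²`. -/
lemma re_le_neg_mul_normSq {δ r : ℝ} {w : ℂ} (hδ : 0 ≤ δ) (hr : 0 < r) (hw : w ≠ 0)
    (hre : w.re ≤ -(δ * ‖w‖)) :
    ((r : ℂ) * w / ((r : ℂ) - w) ^ 2).re ≤
      -((2 + 2 * δ) * ‖(r : ℂ) * w / ((r : ℂ) - w) ^ 2‖ ^ 2) := by
  have hs : 0 < ‖w‖ := norm_pos_iff.2 hw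
  have hsq : ‖w‖ ^ 2 = w.re ^ 2 + w.im ^ 2 := by
    rw [Complex.sq_norm, Complex.normSq_apply]; ring
  have hrw : (r : ℂ) - w ≠ 0 := fun h ↦ by
    have := congrArg Complex.re h
    simp only [Complex.sub_re, Complex.ofReal_re, Complex.zero_re] at this
    nlinarith [mul_nonneg hδ hs.le]
  set u := (r : ℂ) * w / ((r : ℂ) - w) ^ 2 with hu
  have hrc : (r : ℂ) ≠ 0 := by exact_mod_cast hr.ne'
  have hu0 : u ≠ 0 := div_ne_zero (mul_ne_zero hrc hw) (pow_ne_zero 2 hrw)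
  have hinv : u⁻¹ = w / r + r * w⁻¹ - 2 := by
    rw [hu]; field_simp; ring
  have hre_inv : u⁻¹.re = w.re / r + r * (w.re / ‖w‖ ^ 2) - 2 := by
    rw [hinv, Complex.sub_re, Complex.add_re, Complex.div_ofReal_re, Complex.re_ofReal_mul,
      Complex.inv_re, ← Complex.sq_norm]
    simp
  have hbound : w.re / r + r * (w.re / ‖w‖ ^ 2) ≤ -(2 * δ) := by
    have h1 : w.re / r + r * (w.re / ‖w‖ ^ 2) = w.re * (‖w‖ ^ 2 + r ^ 2) / (r * ‖w‖ ^ 2) := by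
      field_simp
    rw [h1, div_le_iff₀ (by positivity)]
    nlinarith [mul_le_mul_of_nonneg_right hre (by positivity : 0 ≤ ‖w‖ ^ 2 + r ^ 2),
      mul_nonneg (mul_nonneg hδ hs.le) (sq_nonneg (‖w‖ - r))]
  have hpos : 0 < ‖u‖ ^ 2 := by positivity
  have hmul : u.re = u⁻¹.re * ‖u‖ ^ 2 := by
    rw [Complex.inv_re, ← Complex.sq_norm]; field_simp
  rw [hmul, hre_inv]
  nlinarith

lemma norm_one_add_mul_le_exp {δ t : ℝ} {u : ℂ} (hδ : 0 ≤ δ)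
    (hu : u.re ≤ -((2 + 2 * δ) * ‖u‖ ^ 2)) :
    ‖1 + (t : ℂ) * u‖ ≤ Real.exp (t * (1 - t / (4 + 4 * δ)) * u.re) := by
  have hsq : ‖1 + (t : ℂ) * u‖ ^ 2 = 1 + 2 * t * u.re + t ^ 2 * ‖u‖ ^ 2 := by
    simp only [Complex.sq_norm, Complex.normSq_apply, Complex.add_re, Complex.add_im,
      Complex.re_ofReal_mul, Complex.im_ofReal_mul, Complex.one_re, Complex.one_im]
    ring
  have hu2 : ‖u‖ ^ 2 ≤ -u.re / (2 + 2 * δ) := by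
    rw [le_div_iff₀ (by positivity)]; linarith
  refine (pow_le_pow_iff_left₀ (norm_nonneg _) (Real.exp_pos _).le two_ne_zero).1 ?_
  rw [hsq, ← Real.exp_nat_mul]
  refine le_trans ?_ (Real.add_one_le_exp _)
  have h4 : t * (1 - t / (4 + 4 * δ)) * u.re = t * u.re + t ^ 2 * (-u.re / (2 + 2 * δ)) / 2 := by
    have : 1 + δ ≠ 0 := by positivity
    field_simp
    ring
  push_cast
  rw [h4]
  nlinarith [mul_le_mul_of_nonneg_left hu2 (sq_nonneg t)]

lemma norm_one_sub_div_mul {r θ : ℝ} {w : ℂ} (hw : w ≠ 0) (hrw : w ≠ r) :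
    ‖1 - (r : ℂ) * Complex.exp ((θ : ℂ) * Complex.I) / w‖ *
        ‖1 - (r : ℂ) * Complex.exp (((-θ : ℝ) : ℂ) * Complex.I) / w‖ =
      ‖1 - (r : ℂ) / w‖ ^ 2 *
        ‖1 + ((2 * (1 - Real.cos θ) : ℝ) : ℂ) * ((r : ℂ) * w / ((r : ℂ) - w) ^ 2)‖ := by
  have hrw' : (r : ℂ) - w ≠ 0 := sub_ne_zero.2 hrw.symm
  have hcos : Complex.exp ((θ : ℂ) * Complex.I) + Complex.exp (((-θ : ℝ) : ℂ) * Complex.I) =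
      2 * (Real.cos θ : ℂ) := by
    rw [Complex.ofReal_cos, Complex.cos, Complex.ofReal_neg]; ring
  have hmul : Complex.exp ((θ : ℂ) * Complex.I) * Complex.exp (((-θ : ℝ) : ℂ) * Complex.I) = 1 := by
    rw [← Complex.exp_add]; simp
  rw [← norm_mul, ← norm_pow, ← norm_mul]
  congr 1
  have hu : (1 - (r : ℂ) / w) ^ 2 * ((r : ℂ) * w / ((r : ℂ) - w) ^ 2) = r / w := by
    field_simp; ring
  rw [Complex.ofReal_mul, Complex.ofReal_sub, Complex.ofReal_one, Complex.ofReal_ofNat]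
  linear_combination (-(r : ℂ) / w) * hcos + (r : ℂ) ^ 2 / w ^ 2 * hmul -
    (2 * (1 - (Real.cos θ : ℂ))) * hu

lemma re_le_neg_sin_mul_norm_s13 {ε : ℝ} {w : ℂ} (hε0 : 0 < ε)
    (h : π / 2 + ε < |Complex.arg w|) : w.re ≤ -(Real.sin ε * ‖w‖) := by
  have hcos : Real.cos (Complex.arg w) ≤ -Real.sin ε := by
    rw [← Real.cos_abs, ← Real.cos_add_pi_div_two, add_comm ε]
    exact Real.cos_le_cos_of_nonneg_of_le_pi (by positivity) (Complex.abs_arg_le_pi w) h.le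
  rw [← Complex.norm_mul_cos_arg w]
  nlinarith [norm_nonneg w]

/-- The factors of a genus-zero product are uniformly bounded below near a non-zero. -/
lemma exists_ball_le_norm_one_sub_div {ι : Type*} {w : ι → ℂ} {z₀ : ℂ}
    (hs : Summable fun k ↦ 1 / ‖w k‖) (hz : ∀ k, 1 - z₀ / w k ≠ 0) :
    ∃ c > 0, ∃ η > 0, ∀ k, ∀ z ∈ Metric.ball z₀ η, c ≤ ‖1 - z / w k‖ := by
  have hlim : Tendsto (fun k ↦ ‖1 - z₀ / w k‖) cofinite (𝓝 1) := by
    have h0 : Tendsto (fun k ↦ z₀ / w k) cofinite (𝓝 0) := by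
      rw [tendsto_zero_iff_norm_tendsto_zero]
      simpa [div_eq_mul_inv] using hs.tendsto_cofinite_zero.const_mul ‖z₀‖
    simpa using (h0.const_sub 1).norm
  have hfin : {k | ¬ (1 / 2 < ‖1 - z₀ / w k‖)}.Finite :=
    hlim.eventually (lt_mem_nhds (by norm_num : (1 / 2 : ℝ) < 1))
  obtain ⟨a, ha, hle⟩ : ∃ a > 0, ∀ k, a ≤ ‖1 - z₀ / w k‖ := by
    rcases hfin.toFinset.eq_empty_or_nonempty with he | hne
    · refine ⟨1 / 2, by norm_num, fun k ↦ ?_⟩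
      by_contra! hk
      have : k ∈ hfin.toFinset := hfin.mem_toFinset.2 hk.le.not_gt
      exact absurd (he ▸ this) (Finset.notMem_empty k)
    · obtain ⟨j, -, hj⟩ := hfin.toFinset.exists_min_image (fun k ↦ ‖1 - z₀ / w k‖) hne
      refine ⟨min (1 / 2) ‖1 - z₀ / w j‖, lt_min (by norm_num) (norm_pos_iff.2 (hz j)),
        fun k ↦ ?_⟩
      by_cases hk : 1 / 2 < ‖1 - z₀ / w k‖
      · exact (min_le_left _ _).trans hk.le
      · exact (min_le_right _ _).trans (hj k (by simpa using hk))
  set M := ∑' k, 1 / ‖w k‖ with hM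
  have hM0 : 0 ≤ M := tsum_nonneg fun k ↦ by positivity
  refine ⟨a / 2, by positivity, a / (2 * (M + 1)), by positivity, fun k z hz ↦ ?_⟩
  have hkM : 1 / ‖w k‖ ≤ M := hs.le_tsum k fun j _ ↦ by positivity
  have hdiff : ‖(1 - z₀ / w k) - (1 - z / w k)‖ ≤ a / 2 := by
    have : (1 - z₀ / w k) - (1 - z / w k) = (z - z₀) * (1 / w k) := by ring
    rw [this, norm_mul, norm_div, norm_one]
    rw [mem_ball_iff_norm] at hz
    calc ‖z - z₀‖ * (1 / ‖w k‖) ≤ a / (2 * (M + 1)) * (M + 1) := by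
          gcongr; linarith
      _ = a / 2 := by field_simp
  linarith [hle k, norm_sub_norm_le (1 - z₀ / w k) (1 - z / w k)]

lemma multipliableLocallyUniformlyOn_one_sub_div {ι : Type*} {w : ι → ℂ}
    (hs : Summable fun k ↦ 1 / ‖w k‖) (z₀ : ℂ) (η : ℝ) :
    MultipliableLocallyUniformlyOn (fun k z ↦ 1 - z / w k) (Metric.ball z₀ η) := by
  simp only [sub_eq_add_neg]
  refine Summable.multipliableLocallyUniformlyOn_one_add Metric.isOpen_ball (hs.mul_left (‖z₀‖ + |η|))
    (Eventually.of_forall fun k z hz ↦ ?_) fun k ↦ by fun_prop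
  rw [norm_neg, norm_div, div_eq_mul_one_div]
  gcongr
  have := norm_le_norm_add_norm_sub' z z₀
  rw [mem_ball_iff_norm] at hz
  linarith [le_abs_self η]

lemma differentiableAt_tprod_one_sub_div {ι : Type*} {w : ι → ℂ}
    (hs : Summable fun k ↦ 1 / ‖w k‖) (z₀ : ℂ) :
    DifferentiableAt ℂ (fun z ↦ ∏' k, (1 - z / w k)) z₀ := by
  have h := (multipliableLocallyUniformlyOn_one_sub_div hs z₀ 1).hasProdLocallyUniformlyOn
  refine (TendstoLocallyUniformlyOn.differentiableOn h (Eventually.of_forall fun T ↦ ?_)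
    Metric.isOpen_ball).differentiableAt (Metric.ball_mem_nhds z₀ one_pos)
  fun_prop

lemma logDeriv_tprod_one_sub_div {ι : Type*} {w : ι → ℂ} {z : ℂ} (hw : ∀ k, w k ≠ 0)
    (hs : Summable fun k ↦ 1 / ‖w k‖) (hz : ∏' k, (1 - z / w k) ≠ 0) :
    logDeriv (fun z ↦ ∏' k, (1 - z / w k)) z = ∑' k, 1 / (z - w k) := by
  have hne : ∀ k, 1 - z / w k ≠ 0 := fun k h ↦ hz (tprod_of_exists_eq_zero ⟨k, h⟩)
  have hterm : ∀ k, logDeriv (fun z ↦ 1 - z / w k) z = 1 / (z - w k) := fun k ↦ by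
    have hd : deriv (fun z ↦ 1 - z / w k) z = -(1 / w k) := by
      simp 
    have h1 := hne k
    have h2 : z - w k ≠ 0 := fun h ↦ h1 (by rw [sub_eq_zero.1 h, div_self (hw k), sub_self])
    have h3 : w k - z ≠ 0 := fun h ↦ h2 (by rw [← neg_sub, h, neg_zero])
    have h4 := hw k
    rw [logDeriv_apply, hd]
    rw [show 1 - z / w k = -(z - w k) / w k by field_simp; ring]
    field_simp
  obtain ⟨c, hc, η, hη, hle⟩ := exists_ball_le_norm_one_sub_div hs hne
  have hsum : Summable fun k ↦ 1 / (z - w k) := by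
    refine Summable.of_norm_bounded (hs.mul_left (1 / c)) fun k ↦ ?_
    have h1 := hle k z (Metric.mem_ball_self hη)
    have h4 : 0 < ‖w k‖ := norm_pos_iff.2 (hw k)
    have h2 : ‖z - w k‖ = ‖1 - z / w k‖ * ‖w k‖ := by
      rw [← norm_mul, ← norm_neg, sub_mul, div_mul_cancel₀ _ (hw k)]; simp
    rw [norm_div, norm_one, h2, ← one_div_mul_one_div]
    gcongr
  rw [logDeriv_tprod_eq_tsum Metric.isOpen_ball (Metric.mem_ball_self hη) hne
    (fun k ↦ by fun_prop) (by simpa only [hterm] using hsum)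
    (multipliableLocallyUniformlyOn_one_sub_div hs z η) hz]
  exact tsum_congr hterm

/-- Termwise differentiation of `z F'(z) / F(z) = ∑ z / (z - wₖ)`. -/
lemma hasSum_deriv_tsum_div_sub {ι : Type*} {w : ι → ℂ} {z₀ : ℂ} (hw : ∀ k, w k ≠ 0)
    (hs : Summable fun k ↦ 1 / ‖w k‖) (hz : ∀ k, 1 - z₀ / w k ≠ 0) :
    DifferentiableAt ℂ (fun z ↦ ∑' k, z / (z - w k)) z₀ ∧
    HasSum (fun k ↦ -(w k / (z₀ - w k) ^ 2)) (deriv (fun z ↦ ∑' k, z / (z - w k)) z₀) := by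
  obtain ⟨c, hc, η, hη, hle⟩ := exists_ball_le_norm_one_sub_div hs hz
  have hnorm : ∀ k z, ‖z - w k‖ = ‖1 - z / w k‖ * ‖w k‖ := fun k z ↦ by
    rw [← norm_mul, ← norm_neg, sub_mul, div_mul_cancel₀ _ (hw k)]; simp
  have hne : ∀ k, ∀ z ∈ Metric.ball z₀ η, z - w k ≠ 0 := fun k z hz ↦ by
    rw [← norm_pos_iff, hnorm]
    exact mul_pos (hc.trans_le (hle k z hz)) (norm_pos_iff.2 (hw k))
  have hdiff : ∀ k, DifferentiableOn ℂ (fun z ↦ z / (z - w k)) (Metric.ball z₀ η) :=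
    fun k z hz ↦ (differentiableAt_fun_id.fun_div
      (differentiableAt_fun_id.sub_const (w k)) (hne k z hz)).differentiableWithinAt
  have hbound : ∀ k, ∀ z ∈ Metric.ball z₀ η,
      ‖z / (z - w k)‖ ≤ (‖z₀‖ + η) / c * (1 / ‖w k‖) := fun k z hz ↦ by
    have h4 : 0 < ‖w k‖ := norm_pos_iff.2 (hw k)
    have h5 := hle k z hz
    rw [norm_div, hnorm, div_mul_div_comm, mul_one]
    have := norm_le_norm_add_norm_sub' z z₀
    rw [mem_ball_iff_norm] at hz
    gcongr
    linarith
  have hmem := Metric.mem_ball_self (x := z₀) hη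
  refine ⟨(Complex.differentiableOn_tsum_of_summable_norm (hs.mul_left _) hdiff Metric.isOpen_ball
    hbound).differentiableAt (Metric.ball_mem_nhds z₀ hη), ?_⟩
  have hterm : (fun k ↦ -(w k / (z₀ - w k) ^ 2)) =
      fun k ↦ deriv (fun z ↦ z / (z - w k)) z₀ := by
    ext k
    have hd := (hasDerivAt_id' z₀).fun_div ((hasDerivAt_id' z₀).sub_const (w k))
      (hne k z₀ hmem)
    rw [hd.deriv, ← neg_div]
    congr 1
    ring
  rw [hterm]
  exact Complex.hasSum_deriv_of_summable_norm (hs.mul_left _) hdiff Metric.isOpen_ball hbound hmem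

/-- The second auxiliary function of a genus-zero product, as a sum over the zeros. -/
lemma hasSum_auxiliary {ι : Type*} {w : ι → ℂ} {F : ℂ → ℂ} {c r : ℝ} {A : ℝ → ℝ}
    (hw : ∀ k, w k ≠ 0) (hs : Summable fun k ↦ 1 / ‖w k‖)
    (hF : ∀ z, F z = (c : ℂ) * ∏' k, (1 - z / w k))
    (hpos : ∀ s : ℝ, 0 < s → 0 < (F s).re) (hreal : ∀ s : ℝ, (F s).im = 0)
    (hA : ∀ s : ℝ, A s = s * deriv (fun s : ℝ ↦ (F s).re) s / (F s).re) (hr : 0 < r) :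
    HasSum (fun k ↦ -((r : ℂ) * w k / ((r : ℂ) - w k) ^ 2).re) (r * deriv A r) := by
  have hne : ∀ s : ℝ, 0 < s → ∏' k, (1 - (s : ℂ) / w k) ≠ 0 := fun s hs0 h ↦ by
    have := hpos s hs0
    simp [hF, h] at this
  have hc : (c : ℂ) ≠ 0 := fun h ↦ by
    have := hpos r hr
    simp [hF, h] at this
  have hfac : ∀ k, 1 - (r : ℂ) / w k ≠ 0 := fun k h ↦
    hne r hr (tprod_of_exists_eq_zero ⟨k, h⟩)
  have hFeq : F = fun z ↦ (c : ℂ) * ∏' k, (1 - z / w k) := funext hF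
  have hFd : ∀ z, DifferentiableAt ℂ F z := fun z ↦ by
    rw [hFeq]; exact (differentiableAt_tprod_one_sub_div hs z).const_mul _
  have hAeq : ∀ s : ℝ, 0 < s → A s = (∑' k, (s : ℂ) / ((s : ℂ) - w k)).re := fun s hs0 ↦ by
    have hlog : logDeriv F s = ∑' k, 1 / ((s : ℂ) - w k) := by
      rw [hFeq, logDeriv_const_mul _ _ hc (f := fun z ↦ ∏' k, (1 - z / w k)),
        logDeriv_tprod_one_sub_div hw hs (hne s hs0)]
    have hFs : F s = ((F s).re : ℂ) := Complex.ext rfl (by simp [hreal])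
    have hd : deriv (fun s : ℝ ↦ (F s).re) s = (deriv F s).re :=
      (hFd s).hasDerivAt.real_of_complex.deriv
    have hdiv : (deriv F s).re / (F s).re = (logDeriv F s).re := by
      rw [logDeriv_apply, hFs, Complex.div_ofReal_re, Complex.ofReal_re]
    rw [hA, hd, mul_div_assoc, hdiv, hlog, ← Complex.re_ofReal_mul, ← tsum_mul_left]
    simp only [mul_one_div]
  obtain ⟨hdiff, hsum⟩ := hasSum_deriv_tsum_div_sub hw hs hfac
  have hderiv : deriv A r = (deriv (fun z ↦ ∑' k, z / (z - w k)) (r : ℂ)).re := by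
    rw [← hdiff.hasDerivAt.real_of_complex.deriv]
    refine Filter.EventuallyEq.deriv_eq ?_
    filter_upwards [lt_mem_nhds hr] with s hs0 using hAeq s hs0
  rw [hderiv, ← Complex.re_ofReal_mul]
  convert Complex.hasSum_re (hsum.mul_left (r : ℂ)) using 2 with k
  rw [← Complex.neg_re, mul_neg, mul_div_assoc]

lemma two_mul_one_sub_cos_le_sq (x : ℝ) : 2 * (1 - Real.cos x) ≤ x ^ 2 := by
  linarith [Real.one_sub_sq_div_two_le_cos (x := x)]

lemma sq_sub_le_two_mul_one_sub_cos {x : ℝ} (hx : |x| ≤ 1) :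
    x ^ 2 - x ^ 4 / 2 ≤ 2 * (1 - Real.cos x) := by
  have h := (abs_le.1 (Real.cos_bound hx)).2
  rw [Even.pow_abs (by decide)] at h
  nlinarith [sq_nonneg (x ^ 2)]

lemma sq_sub_pow_four_le {δ x : ℝ} (hδ : 0 ≤ δ) (hx : |x| ≤ 1) :
    x ^ 2 - x ^ 4 ≤
      2 * (1 - Real.cos x) * (1 - 2 * (1 - Real.cos x) / (4 + 4 * δ)) := by
  set t := 2 * (1 - Real.cos x) with ht
  have ht0 : 0 ≤ t := by linarith [Real.cos_le_one x]
  have h1 : t ≤ x ^ 2 := two_mul_one_sub_cos_le_sq x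
  have h2 := sq_sub_le_two_mul_one_sub_cos hx
  have h3 : t / (4 + 4 * δ) ≤ t / 4 := by gcongr; linarith
  nlinarith [mul_le_mul h1 h1 ht0 (sq_nonneg x), mul_le_mul_of_nonneg_left h3 ht0]

lemma min_le_mul_one_sub_div {δ s t : ℝ} (hδ : 0 ≤ δ) (hst : s ≤ t) (ht : t ≤ 4) :
    min (s * (1 - s / (4 + 4 * δ))) (4 * δ / (1 + δ)) ≤ t * (1 - t / (4 + 4 * δ)) := by
  have hd : 0 < 4 + 4 * δ := by positivity
  rcases le_total (s + t) (4 + 4 * δ) with h | h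
  · refine (min_le_left _ _).trans (sub_nonneg.1 ?_)
    have : t * (1 - t / (4 + 4 * δ)) - s * (1 - s / (4 + 4 * δ)) =
        (t - s) * (4 + 4 * δ - (s + t)) / (4 + 4 * δ) := by field_simp; ring
    rw [this]
    exact div_nonneg (mul_nonneg (by linarith) (by linarith)) hd.le
  · refine (min_le_right _ _).trans (sub_nonneg.1 ?_)
    have : t * (1 - t / (4 + 4 * δ)) - 4 * δ / (1 + δ) =
        (4 - t) * (t - 4 * δ) / (4 + 4 * δ) := by
      have : 1 + δ ≠ 0 := by positivity
      field_simp; ring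
    rw [this]
    exact div_nonneg (mul_nonneg (by linarith) (by linarith)) hd.le

lemma two_mul_one_sub_cos_mono {x θ : ℝ} (hx : 0 ≤ x) (hxθ : x ≤ |θ|) (hθ : |θ| ≤ π) :
    2 * (1 - Real.cos x) ≤ 2 * (1 - Real.cos θ) := by
  have := Real.cos_le_cos_of_nonneg_of_le_pi hx hθ hxθ
  rw [Real.cos_abs] at this
  linarith

/-- The eventual conditions on `r` under which the error terms are absorbed by the factor `2`. -/
lemma eventually_error_le {μ ν δ K K₂ : ℝ} (hμ : 1 / 5 < μ) (hν : 0 < ν) (hδ : 0 < δ) :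
    ∀ᶠ r : ℝ in atTop, 1 ≤ r ∧ K * r ^ (-μ) ≤ 1 ∧ (r ^ (-(2 / 5 : ℝ))) ^ 2 ≤ 4 * δ / (1 + δ) ∧
      (1 + K₂ * r ^ (-ν)) * Real.exp ((r ^ (-(3 / 5 : ℝ)) + K * r ^ (1 / 5 - μ)) / 2) ≤ 2 := by
  have hneg : ∀ a : ℝ, 0 < a → Tendsto (fun r : ℝ ↦ r ^ (-a)) atTop (𝓝 0) :=
    fun a ha ↦ tendsto_rpow_neg_atTop ha
  have h1 : Tendsto (fun r : ℝ ↦ K * r ^ (-μ)) atTop (𝓝 0) := by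
    simpa using (hneg μ (by linarith)).const_mul K
  have h2 : Tendsto (fun r : ℝ ↦ (r ^ (-(2 / 5 : ℝ))) ^ 2) atTop (𝓝 0) := by
    simpa using (hneg (2 / 5) (by norm_num)).pow 2
  have h3 : Tendsto (fun r : ℝ ↦ r ^ (1 / 5 - μ)) atTop (𝓝 0) := by
    simpa using hneg (μ - 1 / 5) (by linarith)
  have h4 : Tendsto (fun r : ℝ ↦ (1 + K₂ * r ^ (-ν)) *
      Real.exp ((r ^ (-(3 / 5 : ℝ)) + K * r ^ (1 / 5 - μ)) / 2)) atTop (𝓝 1) := by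
    have ha := ((hneg ν hν).const_mul K₂).const_add 1
    have hb := (((hneg (3 / 5) (by norm_num)).add (h3.const_mul K)).div_const 2).rexp
    simpa using ha.mul hb
  have hδ' : 0 < 4 * δ / (1 + δ) := by positivity
  filter_upwards [eventually_ge_atTop 1, h1.eventually_le_const one_pos,
    h2.eventually_le_const hδ', h4.eventually_le_const one_lt_two]
    with r hr1 hr2 hr3 hr4 using ⟨hr1, hr2, hr3, hr4⟩

lemma mul_exp_le_two_mul_exp {q x E b h r μ K : ℝ} (hq : 0 ≤ q) (hr : 0 < r) (hK : 0 ≤ K)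
    (hx : |x| ≤ 1) (hKr : K * r ^ (-μ) ≤ 1) (hb : r - K * r ^ (1 - μ) ≤ b)
    (hh : x ^ 2 - x ^ 4 ≤ h) (hE : r * x ^ 4 + K * (r ^ (1 - μ) * x ^ 2) ≤ E)
    (hqE : q * Real.exp (E / 2) ≤ 2) :
    q * Real.exp (-(h * b) / 2) ≤ 2 * Real.exp (-(x ^ 2 * r) / 2) := by
  have hsplit : r ^ (1 - μ) = r * r ^ (-μ) := by
    rw [sub_eq_add_neg, Real.rpow_add hr, Real.rpow_one]
  have hp : 0 ≤ r ^ (1 - μ) := (Real.rpow_pos_of_pos hr _).le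
  have hb0 : 0 ≤ r - K * r ^ (1 - μ) := by rw [hsplit]; nlinarith
  have hx2 : x ^ 2 ≤ 1 := (sq_le_one_iff_abs_le_one x).2 hx
  have hx4 : 0 ≤ x ^ 2 - x ^ 4 := by nlinarith [sq_nonneg x]
  have hhb : x ^ 2 * r - E ≤ h * b := by
    calc x ^ 2 * r - E ≤ (x ^ 2 - x ^ 4) * (r - K * r ^ (1 - μ)) := by
          nlinarith [mul_nonneg (mul_nonneg hK hp) (sq_nonneg (x ^ 2))]
      _ ≤ h * b := mul_le_mul hh hb hb0 (hx4.trans hh)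
  calc q * Real.exp (-(h * b) / 2) ≤ q * Real.exp (E / 2 + -(x ^ 2 * r) / 2) := by
        gcongr; linarith
    _ = q * Real.exp (E / 2) * Real.exp (-(x ^ 2 * r) / 2) := by rw [Real.exp_add, mul_assoc]
    _ ≤ _ := by gcongr

/-- The asymptotic estimate in both ranges of `θ`. -/
lemma eventually_mul_exp_le {μ ν δ K K₂ : ℝ} (hμ : 1 / 5 < μ) (hν : 0 < ν) (hδ : 0 < δ)
    (hK : 0 ≤ K) (hK₂ : 0 ≤ K₂) :
    ∀ᶠ r : ℝ in atTop, ∀ b θ t : ℝ, r - K * r ^ (1 - μ) ≤ b → |θ| ≤ π →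
      t = 2 * (1 - Real.cos θ) →
      (|θ| ≤ r ^ (-(2 / 5 : ℝ)) → (1 + K₂ * r ^ (-ν)) *
        Real.exp (-(t * (1 - t / (4 + 4 * δ)) * b) / 2) ≤ 2 * Real.exp (-(θ ^ 2 * r) / 2)) ∧
      (r ^ (-(2 / 5 : ℝ)) ≤ |θ| → (1 + K₂ * r ^ (-ν)) *
        Real.exp (-(t * (1 - t / (4 + 4 * δ)) * b) / 2) ≤
          2 * Real.exp (-(r ^ ((1 : ℝ) / 5)) / 2)) := by
  filter_upwards [eventually_error_le (K := K) (K₂ := K₂) hμ hν hδ]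
  rintro r ⟨hr1, hKr, hδr, herr⟩ b θ t hb hθ rfl
  have hr : 0 < r := by linarith
  set x := r ^ (-(2 / 5 : ℝ)) with hx
  have hx0 : 0 < x := Real.rpow_pos_of_pos hr _
  have hx1 : x ≤ 1 := Real.rpow_le_one_of_one_le_of_nonpos hr1 (by norm_num)
  have hq : 0 ≤ 1 + K₂ * r ^ (-ν) := by positivity
  have hx4 : r * x ^ 4 = r ^ (-(3 / 5 : ℝ)) := by
    rw [hx, ← Real.rpow_mul_natCast hr.le]
    nth_rewrite 1 [← Real.rpow_one r]
    rw [← Real.rpow_add hr]; norm_num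
  have hx2 : r ^ (1 - μ) * x ^ 2 = r ^ (1 / 5 - μ) := by
    rw [hx, ← Real.rpow_mul_natCast hr.le, ← Real.rpow_add hr]; congr 1; push_cast; ring
  have hx2r : x ^ 2 * r = r ^ ((1 : ℝ) / 5) := by
    rw [hx, ← Real.rpow_mul_natCast hr.le]
    nth_rewrite 2 [← Real.rpow_one r]
    rw [← Real.rpow_add hr]; norm_num
  rw [← hx4, ← hx2] at herr
  have hp : 0 ≤ r ^ (1 - μ) := (Real.rpow_pos_of_pos hr _).le
  refine ⟨fun h ↦ ?_, fun h ↦ ?_⟩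
  · have hsq : θ ^ 2 ≤ x ^ 2 := sq_le_sq' (by linarith [(abs_le.1 h).1]) (abs_le.1 h).2
    refine mul_exp_le_two_mul_exp hq hr hK (h.trans hx1) hKr hb
      (sq_sub_pow_four_le hδ.le (h.trans hx1)) ?_ herr
    have h4 : θ ^ 4 ≤ x ^ 4 := by nlinarith [sq_nonneg θ, sq_nonneg x]
    gcongr
  · rw [← hx2r]
    have hxa : |x| ≤ 1 := by rwa [abs_of_pos hx0]
    refine mul_exp_le_two_mul_exp hq hr hK hxa hKr hb (le_trans (le_min
      (sq_sub_pow_four_le hδ.le hxa) ?_) (min_le_mul_one_sub_div hδ.le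
        (two_mul_one_sub_cos_mono hx0.le h hθ) (by linarith [Real.neg_one_le_cos θ]))) le_rfl herr
    nlinarith [sq_nonneg (x ^ 2)]

/-- Angular decay of a genus-zero product all of whose zeros outside the tame range of `σ` lie in
a left sector. -/
lemma norm_le_mul_exp_of_tame {ι : Type*} {w : ι → ℂ} {F : ℂ → ℂ} {c r θ δ q V t : ℝ} {m : ℕ}
    {zr : Fin m → ℂ} {σ : Fin m → ι} (hr : 0 < r) (hδ : 0 ≤ δ) (hq : 0 ≤ q)
    (hw : ∀ k, w k ≠ 0) (hmul : ∀ z, Multipliable fun k ↦ 1 - z / w k)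
    (hF : ∀ z, F z = (c : ℂ) * ∏' k, (1 - z / w k))
    (hσ : Function.Injective σ) (hzr : ∀ j, w (σ j) = zr j)
    (hsector : ∀ k ∉ Set.range σ, (w k).re ≤ -(δ * ‖w k‖))
    (hV : HasSum (fun k ↦ -((r : ℂ) * w k / ((r : ℂ) - w k) ^ 2).re) V)
    (ht : t = 2 * (1 - Real.cos θ))
    (hconj : ‖F ((r : ℂ) * Complex.exp (((-θ : ℝ) : ℂ) * Complex.I))‖ =
      ‖F ((r : ℂ) * Complex.exp ((θ : ℂ) * Complex.I))‖)
    (hp : ∀ φ : ℝ, |φ| = |θ| →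
      ‖∏ j, ((r : ℂ) * Complex.exp ((φ : ℂ) * Complex.I) - zr j)‖ ≤
        q * ‖∏ j, ((r : ℂ) - zr j)‖) :
    ‖F ((r : ℂ) * Complex.exp ((θ : ℂ) * Complex.I))‖ ≤
      q * ‖F r‖ * Real.exp (-(t * (1 - t / (4 + 4 * δ)) *
        (V + (∑ j, (r : ℂ) * zr j / ((r : ℂ) - zr j) ^ 2).re)) / 2) := by
  set S : Finset ι := Finset.univ.map ⟨σ, hσ⟩ with hS
  set h := t * (1 - t / (4 + 4 * δ)) with hh
  set zp := (r : ℂ) * Complex.exp ((θ : ℂ) * Complex.I) with hzp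
  set zm := (r : ℂ) * Complex.exp (((-θ : ℝ) : ℂ) * Complex.I) with hzm
  have hprod : ∀ z, ∏ k ∈ S, (1 - z / w k) =
      (∏ j, (z - zr j)) * ∏ j, (-(zr j)⁻¹) := fun z ↦ by
    rw [hS, Finset.prod_map, ← Finset.prod_mul_distrib]
    refine Finset.prod_congr rfl fun j _ ↦ ?_
    have hz : zr j ≠ 0 := hzr j ▸ hw (σ j)
    simp only [Function.Embedding.coeFn_mk, hzr]
    field_simp
    ring
  have hblock : ∀ φ : ℝ, |φ| = |θ| →
      ‖∏ k ∈ S, (1 - (r : ℂ) * Complex.exp ((φ : ℂ) * Complex.I) / w k)‖ ≤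
        q * ‖∏ k ∈ S, (1 - (r : ℂ) / w k)‖ := fun φ hφ ↦ by
    rw [hprod, hprod, norm_mul, norm_mul, ← mul_assoc]
    exact mul_le_mul_of_nonneg_right (hp φ hφ) (norm_nonneg _)
  have hfac : ∀ k ∉ S, ‖1 - zp / w k‖ * ‖1 - zm / w k‖ ≤ ‖1 - (r : ℂ) / w k‖ ^ 2 *
      Real.exp (-h * -((r : ℂ) * w k / ((r : ℂ) - w k) ^ 2).re) := fun k hk ↦ by
    have hre := hsector k fun ⟨j, hj⟩ ↦ hk (by simp [hS, ← hj])
    have hwr : w k ≠ r := fun h ↦ by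
      have := mul_nonneg hδ (norm_nonneg (w k))
      rw [h, Complex.ofReal_re, ← h] at hre
      linarith
    rw [hzp, hzm, norm_one_sub_div_mul (hw k) hwr, ← ht, neg_mul_neg]
    gcongr
    exact norm_one_add_mul_le_exp hδ (re_le_neg_mul_normSq hδ hr (hw k) hre)
  have hmain := norm_tprod_mul_norm_tprod_le S (hmul zp) (hmul zm) (hmul r) (hV.mul_left (-h)) hq
    (hblock θ rfl) (hblock (-θ) (abs_neg θ)) hfac
  have hsum : ∑ k ∈ S, -h * -((r : ℂ) * w k / ((r : ℂ) - w k) ^ 2).re =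
      h * (∑ j, (r : ℂ) * zr j / ((r : ℂ) - zr j) ^ 2).re := by
    rw [hS, Finset.sum_map, Complex.re_sum, Finset.mul_sum]
    simp [hzr]
  refine (pow_le_pow_iff_left₀ (norm_nonneg _) (by positivity) two_ne_zero).1 ?_
  calc ‖F zp‖ ^ 2 = ‖F zp‖ * ‖F zm‖ := by rw [hconj, sq]
    _ = ‖(c : ℂ)‖ ^ 2 * (‖∏' k, (1 - zp / w k)‖ * ‖∏' k, (1 - zm / w k)‖) := by
      rw [hF, hF, norm_mul, norm_mul]; ring
    _ ≤ ‖(c : ℂ)‖ ^ 2 * _ := mul_le_mul_of_nonneg_left hmain (by positivity)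
    _ = _ := by
      rw [hF r, norm_mul, mul_pow, ← Real.exp_nat_mul, hsum]
      push_cast
      ring_nf

lemma conj_apply_of_hasSum_real {coef : ℕ → ℝ} {F : ℂ → ℂ}
    (hF : ∀ ζ : ℂ, HasSum (fun i : ℕ ↦ (coef i : ℂ) * ζ ^ i) (F ζ)) (z : ℂ) :
    F ((starRingEnd ℂ) z) = (starRingEnd ℂ) (F z) := by
  refine (hF _).unique ?_
  simpa using (Complex.hasSum_conj').2 (hF z)

lemma re_pos_of_hasSum_pos {coef : ℕ → ℝ} {F : ℂ → ℂ}
    (hF : ∀ ζ : ℂ, HasSum (fun i : ℕ ↦ (coef i : ℂ) * ζ ^ i) (F ζ))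
    (hcoef : ∀ i, 0 < coef i) {s : ℝ} (hs : 0 < s) : 0 < (F s).re := by
  have h := Complex.hasSum_re (hF s)
  simp only [← Complex.ofReal_pow, ← Complex.ofReal_mul, Complex.ofReal_re] at h
  rw [← h.tsum_eq]
  exact h.summable.tsum_pos (fun i ↦ by have := hcoef i; positivity) 0 (by simpa using hcoef 0)

lemma tendsto_sub_rpow_atTop :
    Tendsto (fun n : ℕ ↦ (n : ℝ) - (n : ℝ) ^ ((3 : ℝ) / 5)) atTop atTop := by
  have h : Tendsto (fun x : ℝ ↦ x * (1 - x ^ (-(2 / 5 : ℝ)))) atTop atTop :=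
    tendsto_id.atTop_mul_pos one_pos (by
      simpa using (tendsto_rpow_neg_atTop (by norm_num : (0 : ℝ) < 2 / 5)).const_sub 1)
  refine (h.comp tendsto_natCast_atTop_atTop).congr' ?_
  filter_upwards [eventually_gt_atTop 0] with n hn
  have hn' : (0 : ℝ) < n := by exact_mod_cast hn
  simp only [Function.comp_apply, mul_sub, mul_one]
  congr 1
  nth_rewrite 1 [← Real.rpow_one (n : ℝ)]
  rw [← Real.rpow_add hn']
  norm_num

/-- Uniform Hayman-type bounds for a family of genus-zero entire functions with positive
Maclaurin coefficients whose zeros in the sector `|arg z| ≤ π/2 + ε` are uniformly tame. -/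
theorem stmt_13 (ε μ ν K₁ K₂ K₃ : ℝ)
    (hε0 : 0 < ε) (hε1 : ε < π / 2) (hμ0 : 1 / 5 < μ) (hμ1 : μ ≤ 1 / 3) (hν : 0 < ν)
    (hK₁ : 0 < K₁) (hK₂ : 0 < K₂) (hK₃ : 0 < K₃) :
    ∃ n₀ : ℕ,
      ∀ (ι : ℕ → Type) (_ : ∀ n, Countable (ι n))
        (f : ℕ → ℂ → ℂ) (c : ℕ → ℝ) (w : (n : ℕ) → ι n → ℂ)
        (coef : ℕ → ℕ → ℝ) (m : ℕ → ℕ) (zr : (n : ℕ) → Fin (m n) → ℂ)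
        (A B : ℕ → ℝ → ℝ),
        (∀ n, 0 < c n) →
        (∀ n k, w n k ≠ 0) →
        (∀ n, Summable fun k => 1 / ‖w n k‖) →
        (∀ n, ∀ ζ : ℂ, Multipliable fun k => 1 - ζ / w n k) →
        (∀ n, ∀ ζ : ℂ, f n ζ = (c n : ℂ) * ∏' k, (1 - ζ / w n k)) →
        (∀ n i, 0 < coef n i) →
        (∀ n, ∀ ζ : ℂ, HasSum (fun i : ℕ => (coef n i : ℂ) * ζ ^ i) (f n ζ)) →
        (∀ n, ∃ e : { k : ι n // |Complex.arg (w n k)| ≤ π / 2 + ε } ≃ Fin (m n),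
          ∀ k, zr n (e k) = w n k.1) →
        (∀ n, ∀ j : Fin (m n), ∀ t : ℝ, 0 < t → zr n j ≠ (t : ℂ)) →
        (∀ n, ∀ r : ℝ, A n r = r * deriv (fun s : ℝ => (f n s).re) r / (f n r).re) →
        (∀ n, ∀ r : ℝ, B n r = r * deriv (A n) r) →
        (∀ n : ℕ, ∀ r : ℝ,
          (n : ℝ) - (n : ℝ) ^ ((3 : ℝ) / 5) ≤ r → r ≤ (n : ℝ) + (n : ℝ) ^ ((3 : ℝ) / 5) →
          ‖∑ j : Fin (m n), (r : ℂ) * zr n j / ((r : ℂ) - zr n j) ^ 2‖ ≤ K₁ * r ^ (1 - μ) ∧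
          (∀ θ : ℝ, |θ| ≤ π →
            |‖∏ j : Fin (m n), ((r : ℂ) * Complex.exp ((θ : ℂ) * Complex.I) - zr n j)‖ -
                ‖∏ j : Fin (m n), ((r : ℂ) - zr n j)‖| ≤
              K₂ * ‖∏ j : Fin (m n), ((r : ℂ) - zr n j)‖ * r ^ (-ν)) ∧
          |B n r - r| ≤ K₃ * r ^ ((2 : ℝ) / 3)) →
        ∀ n : ℕ, n₀ ≤ n → ∀ r : ℝ,
          (n : ℝ) - (n : ℝ) ^ ((3 : ℝ) / 5) ≤ r → r ≤ (n : ℝ) + (n : ℝ) ^ ((3 : ℝ) / 5) →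
          ∀ θ : ℝ, |θ| ≤ π →
            (|θ| ≤ r ^ (-(2 / 5 : ℝ)) →
              ‖f n ((r : ℂ) * Complex.exp ((θ : ℂ) * Complex.I))‖ ≤
                2 * (f n r).re * Real.exp (-(θ ^ 2 * r) / 2)) ∧
            (r ^ (-(2 / 5 : ℝ)) ≤ |θ| →
              ‖f n ((r : ℂ) * Complex.exp ((θ : ℂ) * Complex.I))‖ ≤
                2 * (f n r).re * Real.exp (-(r ^ ((1 : ℝ) / 5)) / 2)) := by
  have hδ : 0 < Real.sin ε := Real.sin_pos_of_pos_of_lt_pi hε0 (by linarith [Real.pi_pos])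
  have hev := (eventually_mul_exp_le (K := K₁ + K₃) hμ0 hν hδ (by positivity) hK₂.le).and
    (eventually_ge_atTop 1)
  obtain ⟨R, hR⟩ := eventually_atTop.1 hev
  obtain ⟨n₀, hn₀⟩ := eventually_atTop.1 (tendsto_sub_rpow_atTop.eventually_ge_atTop R)
  refine ⟨n₀, ?_⟩
  intro ι _ f c w coef m zr A B _ hw hs hmul hf hcoef hsum hzr _ hA hB hyp n hn r hr1 hr2 θ hθ
  obtain ⟨hdecay, hr⟩ := hR r ((hn₀ n hn).trans hr1)
  obtain ⟨hU, hp, hBr⟩ := hyp n r hr1 hr2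
  obtain ⟨e, he⟩ := hzr n
  have hr0 : 0 < r := by linarith
  have hconj := conj_apply_of_hasSum_real (hsum n)
  have hpos : ∀ s : ℝ, 0 < s → 0 < (f n s).re := fun s ↦ re_pos_of_hasSum_pos (hsum n) (hcoef n)
  have hreal : ∀ s : ℝ, (f n s).im = 0 := fun s ↦
    Complex.conj_eq_iff_im.1 (by rw [← hconj, Complex.conj_ofReal])
  have hV := hasSum_auxiliary (hw n) (hs n) (hf n) hpos hreal (hA n) hr0
  rw [← hB] at hV
  set U := ∑ j : Fin (m n), (r : ℂ) * zr n j / ((r : ℂ) - zr n j) ^ 2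
  have hb : r - (K₁ + K₃) * r ^ (1 - μ) ≤ B n r + U.re := by
    have h1 := (abs_le.1 ((Complex.abs_re_le_norm U).trans hU)).1
    have h2 := (abs_le.1 hBr).1
    have h3 : r ^ ((2 : ℝ) / 3) ≤ r ^ (1 - μ) :=
      Real.rpow_le_rpow_of_exponent_le hr (by linarith)
    nlinarith
  have hq : 0 ≤ 1 + K₂ * r ^ (-ν) := by positivity
  have hmain := norm_le_mul_exp_of_tame (θ := θ) (σ := fun j ↦ (e.symm j).1) hr0 hδ.le hq (hw n)
    (hmul n) (hf n) (Subtype.val_injective.comp e.symm.injective)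
    (fun j ↦ by rw [← he, e.apply_symm_apply])
    (fun k hk ↦ re_le_neg_sin_mul_norm_s13 hε0
      (not_le.1 fun h ↦ hk ⟨e ⟨k, h⟩, by simp⟩)) hV rfl
    (by
      rw [← Complex.norm_conj, ← hconj, map_mul, Complex.conj_ofReal, ← Complex.exp_conj, map_mul,
        Complex.conj_ofReal, Complex.conj_I, Complex.ofReal_neg, neg_mul_neg])
    (fun φ hφ ↦ by linarith [(abs_le.1 (hp φ (hφ.trans_le hθ))).2])
  have hnorm : ‖f n r‖ = (f n r).re := by
    have h : f n r = ((f n r).re : ℂ) := Complex.ext rfl (by simp [hreal])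
    rw [h, Complex.norm_real, Complex.ofReal_re, Real.norm_of_nonneg (hpos r hr0).le]
  rw [hnorm, mul_right_comm] at hmain
  obtain ⟨h1, h2⟩ := hdecay _ θ _ hb hθ rfl
  refine ⟨fun h ↦ hmain.trans ?_, fun h ↦ hmain.trans ?_⟩
  · rw [mul_right_comm 2 (f n r).re]
    exact mul_le_mul_of_nonneg_right (h1 h) (hpos r hr0).le
  · rw [mul_right_comm 2 (f n r).re]
    exact mul_le_mul_of_nonneg_right (h2 h) (hpos r hr0).le
end
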